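/- The Dirac operator D̸ on F × F satisfies the polynomial identity D̸ ∘ (D̸ − 3·id) ∘ (D̸ + 3·id) = 0, i.e. D̸³ = 9·D̸. -/

import Mathlib

noncomputable section
open DihedralGroup Complex

abbrev D6 := DihedralGroup 6
/-- the reflection `s` -/
def s : D6 := DihedralGroup.sr 0
/-- the rotation `r` of order 6 -/
def rot : D6 := DihedralGroup.r 1
/-- `t = s*r` -/
def t : D6 := s * rot
/-- `x = s*r^3` -/
def x : D6 := s * rot ^ 3
/-- `y = s*r^5` -/
def y : D6 := s * rot ^ 5
/-- `F` is the space of complex-valued functions on `D₆`. -/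
abbrev F := D6 → ℂ

/-- The right-translation operator `(R_a f)(g) = f(g·a)`. -/
def R (a : D6) : Module.End ℂ F := LinearMap.funLeft ℂ ℂ (fun g => g * a)

/-- `ω = exp(iπ/3)`. -/
def ω : ℂ := Complex.exp (Real.pi * Complex.I / 3)

/-- `D₀ = R_t + R_x + R_y`. -/
def D₀ : Module.End ℂ F := R t + R x + R y

/-- `D₁ = ω·R_t + ω³·R_x + ω⁵·R_y`. -/
def D₁ : Module.End ℂ F := ω • R t + ω ^ 3 • R x + ω ^ 5 • R y

/-- `D₂ = ω⁻¹·R_t + ω⁻³·R_x + ω⁻⁵·R_y`. -/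
def D₂ : Module.End ℂ F := ω⁻¹ • R t + (ω ^ 3)⁻¹ • R x + (ω ^ 5)⁻¹ • R y

/-- The Dirac operator `D̸(f₁, f₂) = (−D₀f₁ + D₂f₂, D₁f₁ − D₀f₂)` on `F × F`. -/
def Dir : Module.End ℂ (F × F) :=
  LinearMap.prod (D₂ ∘ₗ LinearMap.snd ℂ F F - D₀ ∘ₗ LinearMap.fst ℂ F F)
    (D₁ ∘ₗ LinearMap.fst ℂ F F - D₀ ∘ₗ LinearMap.snd ℂ F F)

lemma omega_sq : ω ^ 2 = ω - 1 := by
  have h : ω = 1 / 2 + (Real.sqrt 3 / 2 : ℝ) * Complex.I := by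
    have h' : (Real.pi * Complex.I / 3 : ℂ) = ((Real.pi / 3 : ℝ) : ℂ) * Complex.I := by
      push_cast; ring
    rw [ω, h', Complex.exp_mul_I, ← Complex.ofReal_cos, ← Complex.ofReal_sin,
      Real.cos_pi_div_three, Real.sin_pi_div_three]
    push_cast; ring
  have h3 : ((Real.sqrt 3 : ℝ) : ℂ) ^ 2 = 3 := by
    rw [← Complex.ofReal_pow, Real.sq_sqrt (by norm_num)]; norm_num
  rw [h]
  push_cast
  linear_combination (1 / 4 : ℂ) * Complex.I ^ 2 * h3 + (3 / 4 : ℂ) * Complex.I_sq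

lemma omega_pow_three : ω ^ 3 = -1 := by
  linear_combination (ω + 1) * omega_sq

lemma omega_pow_five : ω ^ 5 = 1 - ω := by
  linear_combination ω ^ 2 * omega_pow_three - omega_sq

lemma omega_inv : ω⁻¹ = 1 - ω :=
  inv_eq_of_mul_eq_one_right (by linear_combination -omega_sq)

lemma D₁_eq : D₁ = ω • R t - R x + (1 - ω) • R y := by
  rw [D₁, omega_pow_three, omega_pow_five]; module

lemma D₂_eq : D₂ = (1 - ω) • R t - R x + ω • R y := by
  have h : (1 - ω)⁻¹ = ω := by rw [← omega_inv, inv_inv]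
  rw [D₂, omega_pow_three, omega_pow_five, omega_inv, h, inv_neg_one]; module

lemma R_mul_R (a b : D6) : R a * R b = R (a * b) := by
  ext f g
  simp [R, LinearMap.funLeft_apply, mul_assoc]

lemma t_mul_t : t * t = 1 := by decide
lemma x_mul_x : x * x = 1 := by decide
lemma y_mul_y : y * y = 1 := by decide
lemma x_mul_y : x * y = t * x := by decide
lemma y_mul_t : y * t = t * x := by decide
lemma y_mul_x : y * x = x * t := by decide
lemma t_mul_y : t * y = x * t := by decide
lemma t_mul_x_mul_t : t * x * t = y := by decide
lemma t_mul_x_mul_x : t * x * x = t := by decide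
lemma t_mul_x_mul_y : t * x * y = x := by decide
lemma x_mul_t_mul_t : x * t * t = x := by decide
lemma x_mul_t_mul_x : x * t * x = y := by decide
lemma x_mul_t_mul_y : x * t * y = t := by decide

lemma D₀_mul_D₁ : D₀ * D₁ = 0 := by
  simp only [D₀, D₁_eq, mul_add, add_mul, mul_sub, mul_smul_comm, R_mul_R,
    t_mul_t, x_mul_x, y_mul_y, x_mul_y, y_mul_t, y_mul_x, t_mul_y]
  module

lemma D₁_mul_D₀ : D₁ * D₀ = 0 := by
  simp only [D₀, D₁_eq, mul_add, add_mul, sub_mul, smul_mul_assoc, R_mul_R,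
    t_mul_t, x_mul_x, y_mul_y, x_mul_y, y_mul_t, y_mul_x, t_mul_y]
  module

lemma D₀_mul_D₂ : D₀ * D₂ = 0 := by
  simp only [D₀, D₂_eq, mul_add, add_mul, mul_sub, mul_smul_comm, R_mul_R,
    t_mul_t, x_mul_x, y_mul_y, x_mul_y, y_mul_t, y_mul_x, t_mul_y]
  module

lemma D₂_mul_D₀ : D₂ * D₀ = 0 := by
  simp only [D₀, D₂_eq, mul_add, add_mul, sub_mul, smul_mul_assoc, R_mul_R,
    t_mul_t, x_mul_x, y_mul_y, x_mul_y, y_mul_t, y_mul_x, t_mul_y]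
  module

lemma D₀_sq : D₀ * D₀ = (3 : ℂ) • (R 1 + R (t * x) + R (x * t)) := by
  simp only [D₀, mul_add, add_mul, R_mul_R,
    t_mul_t, x_mul_x, y_mul_y, x_mul_y, y_mul_t, y_mul_x, t_mul_y]
  module

lemma D₁_mul_D₂ : D₁ * D₂ = (3 : ℂ) • (R 1 - ω • R (t * x) + (ω - 1) • R (x * t)) := by
  simp only [D₁_eq, D₂_eq, mul_add, add_mul, mul_sub, sub_mul, smul_mul_assoc, mul_smul_comm,
    R_mul_R, t_mul_t, x_mul_x, y_mul_y, x_mul_y, y_mul_t, y_mul_x, t_mul_y]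
  match_scalars <;> grind [omega_sq]

lemma D₂_mul_D₁ : D₂ * D₁ = (3 : ℂ) • (R 1 + (ω - 1) • R (t * x) - ω • R (x * t)) := by
  simp only [D₁_eq, D₂_eq, mul_add, add_mul, mul_sub, sub_mul, smul_mul_assoc, mul_smul_comm,
    R_mul_R, t_mul_t, x_mul_x, y_mul_y, x_mul_y, y_mul_t, y_mul_x, t_mul_y]
  match_scalars <;> grind [omega_sq]

lemma D₀_cube : D₀ * D₀ * D₀ = (9 : ℂ) • D₀ := by
  rw [D₀_sq]
  simp only [D₀, mul_add, add_mul, smul_mul_assoc, R_mul_R, one_mul, t_mul_x_mul_t, t_mul_x_mul_x,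
    t_mul_x_mul_y, x_mul_t_mul_t, x_mul_t_mul_x, x_mul_t_mul_y]
  module

lemma D₁_mul_D₂_mul_D₁ : D₁ * D₂ * D₁ = (9 : ℂ) • D₁ := by
  rw [D₁_mul_D₂]
  simp only [D₁_eq, mul_add, add_mul, mul_sub, sub_mul, smul_mul_assoc, mul_smul_comm, R_mul_R,
    one_mul, t_mul_x_mul_t, t_mul_x_mul_x, t_mul_x_mul_y, x_mul_t_mul_t, x_mul_t_mul_x,
    x_mul_t_mul_y]
  match_scalars <;> grind [omega_sq]

lemma D₂_mul_D₁_mul_D₂ : D₂ * D₁ * D₂ = (9 : ℂ) • D₂ := by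
  rw [D₂_mul_D₁]
  simp only [D₂_eq, mul_add, add_mul, mul_sub, sub_mul, smul_mul_assoc, mul_smul_comm, R_mul_R,
    one_mul, t_mul_x_mul_t, t_mul_x_mul_x, t_mul_x_mul_y, x_mul_t_mul_t, x_mul_t_mul_x,
    x_mul_t_mul_y]
  match_scalars <;> grind [omega_sq]

lemma Dir_apply (f : F × F) : Dir f = (D₂ f.2 - D₀ f.1, D₁ f.1 - D₀ f.2) := rfl

lemma Dir_pow_three : Dir ^ 3 = (9 : ℂ) • Dir := by
  have h01 (f : F) : D₀ (D₁ f) = 0 := LinearMap.congr_fun D₀_mul_D₁ f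
  have h10 (f : F) : D₁ (D₀ f) = 0 := LinearMap.congr_fun D₁_mul_D₀ f
  have h02 (f : F) : D₀ (D₂ f) = 0 := LinearMap.congr_fun D₀_mul_D₂ f
  have h20 (f : F) : D₂ (D₀ f) = 0 := LinearMap.congr_fun D₂_mul_D₀ f
  have h000 (f : F) : D₀ (D₀ (D₀ f)) = (9 : ℂ) • D₀ f := LinearMap.congr_fun D₀_cube f
  have h121 (f : F) : D₁ (D₂ (D₁ f)) = (9 : ℂ) • D₁ f := LinearMap.congr_fun D₁_mul_D₂_mul_D₁ f
  have h212 (f : F) : D₂ (D₁ (D₂ f)) = (9 : ℂ) • D₂ f := LinearMap.congr_fun D₂_mul_D₁_mul_D₂ f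
  refine LinearMap.ext fun f => ?_
  simp only [pow_succ, pow_zero, one_mul, Module.End.mul_apply, LinearMap.smul_apply, Dir_apply,
    map_sub, map_add, h01, h10, h02, h20, h000, h121, h212, Prod.smul_mk, smul_sub, sub_zero,
    zero_sub, sub_neg_eq_add, add_zero, zero_add]

/-- The Dirac operator satisfies `D̸ ∘ (D̸ − 3·id) ∘ (D̸ + 3·id) = 0`, i.e. `D̸³ = 9·D̸`. -/
theorem dirac_cubic :
    Dir * (Dir - (3 : ℂ) • (1 : Module.End ℂ (F × F)))
        * (Dir + (3 : ℂ) • (1 : Module.End ℂ (F × F))) = 0 ∧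
    Dir ^ 3 = (9 : ℂ) • Dir := by
  refine ⟨?_, Dir_pow_three⟩
  have h : Dir * (Dir - (3 : ℂ) • (1 : Module.End ℂ (F × F)))
      * (Dir + (3 : ℂ) • (1 : Module.End ℂ (F × F))) = Dir ^ 3 - (9 : ℂ) • Dir := by
    simp only [pow_succ, pow_zero, one_mul, mul_add, mul_sub, sub_mul, mul_smul_comm,
      smul_mul_assoc, mul_one]
    module
  rw [h, Dir_pow_three, sub_self]
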